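/- arXiv:2409.07052 — 2 statements merged into one kernel-verified Lean document; each statement's English description precedes it below -/
import Mathlib

section
/- Let α ∈ (1,2] and k ∈ ℕ. There exists a constant C = C(α,k) > 0 such that for all x ∈ ℝ, the k-th derivative of G satisfies |D^k G(x)| ≤ C / (1 + |x|^{1+α+k}). -/
open MeasureTheory

/-- The fractional heat kernel at time 1:
`G(x) = (1/(2π)) ∫_ℝ exp(−iξx − |ξ|^α) dξ` (real part; the integral is real-valued). -/
noncomputable def GKernel (α : ℝ) (x : ℝ) : ℝ :=
  (1 / (2 * Real.pi)) *
    ∫ ξ : ℝ, (Complex.exp (-(Complex.I * (ξ : ℂ) * (x : ℂ)) - ((|ξ| ^ α : ℝ) : ℂ))).re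

open Set

/-- The rotated integrand. -/
noncomputable def Phi (k : ℕ) (α x θ r : ℝ) : ℂ :=
  Complex.I ^ k * Complex.exp (Complex.I * (k + 1) * θ) * (r : ℂ) ^ k *
    Complex.exp (Complex.I * r * Complex.exp (Complex.I * θ) * x
      - ((r ^ α : ℝ) : ℂ) * Complex.exp (Complex.I * α * θ))

noncomputable def PhiD (k : ℕ) (α x θ r : ℝ) : ℂ :=
  (k + 1 + Complex.I * r * Complex.exp (Complex.I * θ) * x
      - α * ((r ^ α : ℝ) : ℂ) * Complex.exp (Complex.I * α * θ)) * Phi k α x θ r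

lemma norm_expI (a : ℝ) : ‖Complex.exp (Complex.I * a)‖ = 1 := by
  rw [mul_comm, Complex.norm_exp_ofReal_mul_I]

lemma re_expI (a : ℝ) : (Complex.exp (Complex.I * a)).re = Real.cos a := by
  rw [mul_comm, Complex.exp_ofReal_mul_I_re]

lemma im_expI (a : ℝ) : (Complex.exp (Complex.I * a)).im = Real.sin a := by
  rw [mul_comm, Complex.exp_ofReal_mul_I_im]

lemma norm_Phi (k : ℕ) (α x θ r : ℝ) (hr : 0 ≤ r) :
    ‖Phi k α x θ r‖ = r ^ k * Real.exp (-(r * x * Real.sin θ) - r ^ α * Real.cos (α * θ)) := by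
  unfold Phi
  have h1 : Complex.I * (k + 1) * (θ : ℂ) = Complex.I * (((k + 1) * θ : ℝ) : ℂ) := by
    push_cast; ring
  have h2 : Complex.I * (α : ℂ) * (θ : ℂ) = Complex.I * ((α * θ : ℝ) : ℂ) := by
    push_cast; ring
  have h3 : Complex.I * (r : ℂ) * Complex.exp (Complex.I * θ) * x
     = Complex.I * (((r * x : ℝ) : ℂ) * Complex.exp (Complex.I * θ)) := by push_cast; ring
  rw [h1, h2, h3, norm_mul, norm_mul, norm_mul, norm_expI, norm_pow, norm_pow, Complex.norm_I,
    Complex.norm_exp, Complex.norm_real, Real.norm_of_nonneg hr, Complex.sub_re, Complex.I_mul_re,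
    Complex.im_ofReal_mul, Complex.re_ofReal_mul, re_expI, im_expI]
  simp

lemma hasDerivAt_Phi_theta (k : ℕ) (α x θ r : ℝ) :
    HasDerivAt (fun θ : ℝ => Phi k α x θ r) (Complex.I * PhiD k α x θ r) θ := by
  unfold PhiD Phi
  have h0 : HasDerivAt (fun θ : ℝ => (θ : ℂ)) 1 θ := Complex.ofRealCLM.hasDerivAt
  have h1 := (h0.const_mul (Complex.I * (k + 1))).cexp
  have h2 := (h0.const_mul Complex.I).cexp
  have h3 := (h0.const_mul (Complex.I * α)).cexp
  have h4 := (((h2.const_mul (Complex.I * r)).mul_const (x : ℂ)).sub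
    (h3.const_mul ((r ^ α : ℝ) : ℂ))).cexp
  refine (((h1.const_mul (Complex.I ^ k)).mul_const ((r : ℂ) ^ k)).mul h4).congr_deriv ?_
  simp only [Pi.sub_apply]
  ring

lemma hasDerivAt_Phi_r (k : ℕ) (α x θ r : ℝ) (hr : 0 < r) :
    HasDerivAt (fun r : ℝ => (r : ℂ) * Phi k α x θ r) (PhiD k α x θ r) r := by
  have h0 : HasDerivAt (fun r : ℝ => (r : ℂ)) 1 r := Complex.ofRealCLM.hasDerivAt
  have h1 := h0.pow (k + 1)
  have h2 : HasDerivAt (fun r : ℝ => ((r ^ α : ℝ) : ℂ)) ((α * r ^ (α - 1) : ℝ) : ℂ) r :=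
    (Real.hasDerivAt_rpow_const (p := α) (Or.inl hr.ne')).ofReal_comp
  have h4 := ((((h0.const_mul Complex.I).mul_const (Complex.exp (Complex.I * θ))).mul_const
    (x : ℂ)).sub (h2.mul_const (Complex.exp (Complex.I * α * θ)))).cexp
  have h5 := ((h1.const_mul (Complex.I ^ k * Complex.exp (Complex.I * (k + 1) * θ))).mul h4)
  have h6 : r ^ α = r * r ^ (α - 1) := by
    rw [Real.rpow_sub_one hr.ne']; field_simp
  refine (h5.congr_of_eventuallyEq (Filter.Eventually.of_forall fun r => ?_)).congr_deriv ?_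
  · simp only [Phi, Pi.mul_apply, Pi.pow_apply, Pi.sub_apply]; ring
  · simp only [Phi, PhiD, Pi.pow_apply, Pi.sub_apply, h6]; push_cast; simp; ring

lemma integrable_pow_exp_rpow (k : ℕ) (α b : ℝ) (hα : 0 < α) (hb : 0 < b) :
    IntegrableOn (fun r : ℝ => r ^ k * Real.exp (-b * r ^ α)) (Ioi 0) := by
  have := integrableOn_rpow_mul_exp_neg_mul_rpow (p := α) (s := k) (b := b)
    (by have : (0:ℝ) ≤ k := Nat.cast_nonneg k
        linarith) hα hb
  simpa only [Real.rpow_natCast] using this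

lemma integrable_cpow_exp (k : ℕ) (a : ℂ) (ha : 0 < a.re) :
    IntegrableOn (fun r : ℝ => (r : ℂ) ^ k * Complex.exp (-(a * r))) (Ioi 0) := by
  have h := integrable_pow_exp_rpow k 1 a.re one_pos ha
  refine Integrable.mono' h (by fun_prop) ?_
  refine (ae_restrict_iff' measurableSet_Ioi).2 (Filter.Eventually.of_forall fun r hr => ?_)
  have hr : 0 < r := hr
  rw [norm_mul, norm_pow, Complex.norm_real, Real.norm_of_nonneg hr.le, Complex.norm_exp,
    Real.rpow_one]
  simp

lemma integral_cpow_exp (k : ℕ) (a : ℂ) (ha : 0 < a.re) :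
    ∫ r in Ioi (0:ℝ), (r : ℂ) ^ k * Complex.exp (-(a * r)) = k.factorial / a ^ (k + 1) := by
  have ha0 : a ≠ 0 := by rintro rfl; simp at ha
  have h0 (r : ℝ) : HasDerivAt (fun r : ℝ => (r : ℂ)) 1 r := Complex.ofRealCLM.hasDerivAt
  induction k with
  | zero =>
    have hd : ∀ r ∈ Ioi (0:ℝ), HasDerivAt (fun r : ℝ => -a⁻¹ * Complex.exp (-(a * r)))
        ((r : ℂ) ^ 0 * Complex.exp (-(a * r))) r := fun r _ => by
      refine ((((h0 r).const_mul a).neg.cexp).const_mul (-a⁻¹)).congr_deriv ?_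
      simp; field_simp
    have hi := integrable_cpow_exp 0 a ha
    have hi' : IntegrableOn (fun r : ℝ => -a⁻¹ * Complex.exp (-(a * r))) (Ioi 0) := by
      have := hi.const_mul (-a⁻¹)
      simpa [IntegrableOn] using this
    have := integral_Ioi_of_hasDerivAt_of_tendsto (by
      apply Continuous.continuousWithinAt; fun_prop) hd hi
        (tendsto_zero_of_hasDerivAt_of_integrableOn_Ioi hd hi hi')
    rw [this]; simp
  | succ k ih =>
    have hd : ∀ r ∈ Ioi (0:ℝ), HasDerivAt (fun r : ℝ => (r : ℂ) ^ (k + 1) * Complex.exp (-(a * r)))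
        ((k + 1) * ((r : ℂ) ^ k * Complex.exp (-(a * r)))
          - a * ((r : ℂ) ^ (k + 1) * Complex.exp (-(a * r)))) r := fun r _ => by
      refine (((h0 r).pow (k + 1)).mul ((h0 r).const_mul a).neg.cexp).congr_deriv ?_
      simp; ring
    have i1 := (integrable_cpow_exp k a ha).const_mul ((k : ℂ) + 1)
    have i2 := (integrable_cpow_exp (k + 1) a ha)
    have hi := i1.sub (i2.const_mul a)
    have := integral_Ioi_of_hasDerivAt_of_tendsto (by
      apply Continuous.continuousWithinAt; fun_prop) hd hi
        (tendsto_zero_of_hasDerivAt_of_integrableOn_Ioi hd hi i2)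
    rw [integral_sub i1 (i2.const_mul a), integral_const_mul, integral_const_mul, ih] at this
    simp at this
    have h2 := sub_eq_zero.1 this
    rw [Nat.factorial_succ]
    push_cast
    rw [eq_div_iff (pow_ne_zero _ ha0), pow_succ a (k + 1)]
    have hp : a ^ (k + 1) ≠ 0 := pow_ne_zero _ ha0
    have h3 := congrArg (fun z => z * a ^ (k + 1)) h2
    rw [mul_assoc, div_mul_cancel₀ _ hp] at h3
    linear_combination -h3

lemma aesm_Phi (k : ℕ) (α x θ : ℝ) :
    AEStronglyMeasurable (Phi k α x θ) (volume.restrict (Ioi 0)) := by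
  unfold Phi
  exact Measurable.aestronglyMeasurable (by fun_prop)

lemma aesm_PhiD (k : ℕ) (α x θ : ℝ) :
    AEStronglyMeasurable (PhiD k α x θ) (volume.restrict (Ioi 0)) := by
  unfold PhiD Phi
  exact Measurable.aestronglyMeasurable (by fun_prop)

lemma cos_bound {α θ : ℝ} (hα : 1 < α) (hα' : α ≤ 2) (h0 : 0 ≤ θ) (h1 : θ ≤ Real.pi / 8) :
    Real.cos (Real.pi / 4) ≤ Real.cos (α * θ) := by
  apply Real.cos_le_cos_of_nonneg_of_le_pi (by positivity) (by linarith [Real.pi_pos])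
  nlinarith

lemma cpos : 0 < Real.cos (Real.pi / 4) := by
  rw [Real.cos_pi_div_four]; positivity

lemma Phi_le {α x θ r : ℝ} (k : ℕ) (hα : 1 < α) (hα' : α ≤ 2) (hx : 0 ≤ x ∨ θ = 0) (h0 : 0 ≤ θ)
    (h1 : θ ≤ Real.pi / 8) (hr : 0 < r) :
    ‖Phi k α x θ r‖ ≤ r ^ k * Real.exp (-Real.cos (Real.pi / 4) * r ^ α) := by
  rw [norm_Phi _ _ _ _ _ hr.le]
  have hs : 0 ≤ x * Real.sin θ := by
    rcases hx with hx | hx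
    · exact mul_nonneg hx (Real.sin_nonneg_of_nonneg_of_le_pi h0 (by linarith [Real.pi_pos]))
    · simp [hx]
  have := cos_bound hα hα' h0 h1
  have h3 : 0 ≤ r ^ α := Real.rpow_nonneg hr.le _
  gcongr
  nlinarith [mul_nonneg hr.le hs]

lemma integrable_Phi {α x θ : ℝ} (k : ℕ) (hα : 1 < α) (hα' : α ≤ 2) (hx : 0 ≤ x ∨ θ = 0)
    (h0 : 0 ≤ θ) (h1 : θ ≤ Real.pi / 8) : IntegrableOn (Phi k α x θ) (Ioi 0) := by
  refine Integrable.mono' (integrable_pow_exp_rpow k α _ (by linarith) cpos) (aesm_Phi _ _ _ _) ?_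
  exact (ae_restrict_iff' measurableSet_Ioi).2 (Filter.Eventually.of_forall fun r hr =>
    Phi_le k hα hα' hx h0 h1 hr)

noncomputable def bd (k : ℕ) (α x r : ℝ) : ℝ :=
  (k + 1 + r * x + α * r ^ α) * (r ^ k * Real.exp (-Real.cos (Real.pi / 4) * r ^ α))

lemma integrable_bd {α : ℝ} (x : ℝ) (k : ℕ) (hα : 1 < α) :
    IntegrableOn (bd k α x) (Ioi 0) := by
  have h1 := (integrable_pow_exp_rpow k α _ (by linarith) cpos).const_mul ((k : ℝ) + 1)
  have h2 := (integrable_pow_exp_rpow (k + 1) α _ (by linarith) cpos).const_mul x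
  have h3 := (integrableOn_rpow_mul_exp_neg_mul_rpow (p := α) (s := α + k)
    (by have : (0:ℝ) ≤ k := Nat.cast_nonneg k
        linarith) (by linarith) cpos).const_mul α
  refine IntegrableOn.congr_fun ((h1.add h2).add h3) (fun r hr => ?_) measurableSet_Ioi
  have hr : 0 < r := hr
  simp only [bd, Pi.add_apply, Real.rpow_add hr, Real.rpow_natCast]
  ring

lemma PhiD_le {α x θ r : ℝ} (k : ℕ) (hα : 1 < α) (hα' : α ≤ 2) (hx : 0 ≤ x) (h0 : 0 ≤ θ)
    (h1 : θ ≤ Real.pi / 8) (hr : 0 < r) :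
    ‖PhiD k α x θ r‖ ≤ bd k α x r := by
  unfold PhiD bd
  rw [norm_mul]
  have hr' : 0 ≤ r ^ α := Real.rpow_nonneg hr.le _
  refine mul_le_mul ?_ (Phi_le k hα hα' (Or.inl hx) h0 h1 hr) (norm_nonneg _) (by positivity)
  have h2 : Complex.I * (α : ℂ) * (θ : ℂ) = Complex.I * ((α * θ : ℝ) : ℂ) := by
    push_cast; ring
  have h3 : ((k : ℂ) + 1) = ((k + 1 : ℝ) : ℂ) := by push_cast; rfl
  refine (norm_sub_le _ _).trans (add_le_add ((norm_add_le _ _).trans (add_le_add ?_ ?_)) ?_)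
  · rw [h3, Complex.norm_real, Real.norm_of_nonneg (by positivity)]
  · simp only [norm_mul, norm_expI, Complex.norm_real, Complex.norm_I, Real.norm_of_nonneg hr.le,
      Real.norm_of_nonneg hx]
    simp
  · rw [h2]
    simp only [norm_mul, norm_expI, Complex.norm_real, Real.norm_of_nonneg hr',
      Real.norm_of_nonneg (by linarith : 0 ≤ α)]
    simp

lemma integrable_PhiD {α x θ : ℝ} (k : ℕ) (hα : 1 < α) (hα' : α ≤ 2) (hx : 0 ≤ x)
    (h0 : 0 ≤ θ) (h1 : θ ≤ Real.pi / 8) : IntegrableOn (PhiD k α x θ) (Ioi 0) := by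
  refine Integrable.mono' (integrable_bd x k hα) (aesm_PhiD _ _ _ _) ?_
  exact (ae_restrict_iff' measurableSet_Ioi).2 (Filter.Eventually.of_forall fun r hr =>
    PhiD_le k hα hα' hx h0 h1 hr)

lemma mul_Phi (k : ℕ) (α x θ r : ℝ) : (r : ℂ) * Phi k α x θ r =
    Complex.I ^ k * (Complex.I⁻¹ ^ (k + 1)) * Complex.exp (-(Complex.I * θ)) *
      Phi (k + 1) α x θ r := by
  unfold Phi
  have : Complex.exp (Complex.I * (((k + 1 : ℕ) : ℂ) + 1) * θ) =
    Complex.exp (Complex.I * (k + 1) * θ) * Complex.exp (Complex.I * θ) := by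
    rw [← Complex.exp_add]; congr 1; push_cast; ring
  rw [this, Complex.exp_neg]
  have h1 := Complex.exp_ne_zero (Complex.I * θ)
  have h2 : Complex.I⁻¹ ^ (k + 1) * Complex.I ^ (k + 1) = 1 := by
    rw [← mul_pow, inv_mul_cancel₀ Complex.I_ne_zero, one_pow]
  field_simp
  rw [← one_div] at h2
  rw [h2]; ring

lemma integral_PhiD {α x θ : ℝ} (k : ℕ) (hα : 1 < α) (hα' : α ≤ 2) (hx : 0 ≤ x)
    (h0 : 0 ≤ θ) (h1 : θ ≤ Real.pi / 8) : ∫ r in Ioi (0:ℝ), PhiD k α x θ r = 0 := by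
  have hd : ∀ r ∈ Ioi (0:ℝ), HasDerivAt (fun r : ℝ => (r : ℂ) * Phi k α x θ r)
    (PhiD k α x θ r) r := fun r hr => hasDerivAt_Phi_r k α x θ r hr
  have hi := integrable_PhiD k hα hα' hx h0 h1
  have hi2 : IntegrableOn (fun r : ℝ => (r : ℂ) * Phi k α x θ r) (Ioi 0) := by
    simp only [mul_Phi]
    exact (integrable_Phi (k + 1) hα hα' (Or.inl hx) h0 h1).const_mul _
  have hc : ContinuousWithinAt (fun r : ℝ => (r : ℂ) * Phi k α x θ r) (Ici 0) 0 := by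
    unfold Phi
    apply Continuous.continuousWithinAt
    have : Continuous (fun r : ℝ => r ^ α) := Real.continuous_rpow_const (by linarith)
    fun_prop
  rw [integral_Ioi_of_hasDerivAt_of_tendsto hc hd hi
    (tendsto_zero_of_hasDerivAt_of_integrableOn_Ioi hd hi hi2)]
  simp

lemma hasDerivAt_re {f : ℝ → ℂ} {f' : ℂ} {x : ℝ} (h : HasDerivAt f f' x) :
    HasDerivAt (fun x => (f x).re) f'.re x :=
  Complex.reCLM.hasFDerivAt.comp_hasDerivAt x h

lemma rotate {α x : ℝ} (k : ℕ) (hα : 1 < α) (hα' : α ≤ 2) (hx : 0 ≤ x) :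
    (∫ r in Ioi (0:ℝ), Phi k α x 0 r).re = (∫ r in Ioi (0:ℝ), Phi k α x (Real.pi / 8) r).re := by
  have hpi : 0 < Real.pi / 8 := by positivity
  have hcont : ContinuousOn (fun θ => ∫ r in Ioi (0:ℝ), Phi k α x θ r) (Icc 0 (Real.pi / 8)) := by
    refine continuousOn_of_dominated (fun θ _ => aesm_Phi _ _ _ _) (fun θ hθ => ?_)
      (integrable_pow_exp_rpow k α _ (by linarith) cpos) ?_
    · exact (ae_restrict_iff' measurableSet_Ioi).2 (Filter.Eventually.of_forall fun r hr =>
        Phi_le k hα hα' (Or.inl hx) hθ.1 hθ.2 hr)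
    · refine Filter.Eventually.of_forall fun r => ?_
      exact fun θ _ => (hasDerivAt_Phi_theta k α x θ r).continuousAt.continuousWithinAt
  have hder : ∀ θ ∈ Ioo 0 (Real.pi / 8),
      HasDerivAt (fun θ => ∫ r in Ioi (0:ℝ), Phi k α x θ r) 0 θ := by
    intro θ hθ
    have := (hasDerivAt_integral_of_dominated_loc_of_deriv_le (𝕜 := ℝ)
      (μ := volume.restrict (Ioi (0:ℝ))) (F := fun θ r => Phi k α x θ r)
      (F' := fun θ r => Complex.I * PhiD k α x θ r) (x₀ := θ) (bound := bd k α x)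
      (Ioo_mem_nhds hθ.1 hθ.2)
      (Filter.Eventually.of_forall fun θ => aesm_Phi _ _ _ _)
      (integrable_Phi k hα hα' (Or.inl hx) hθ.1.le hθ.2.le)
      ((aesm_PhiD _ _ _ _).const_mul _)
      ((ae_restrict_iff' measurableSet_Ioi).2 (Filter.Eventually.of_forall fun r hr t ht => by
        rw [norm_mul, Complex.norm_I, one_mul]
        exact PhiD_le k hα hα' hx ht.1.le ht.2.le hr))
      (integrable_bd x k hα)
      (Filter.Eventually.of_forall fun r t _ => hasDerivAt_Phi_theta k α x t r)).2
    rwa [integral_const_mul, integral_PhiD k hα hα' hx hθ.1.le hθ.2.le, mul_zero] at this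
  obtain ⟨c, hc, h⟩ := exists_hasDerivAt_eq_slope
    (fun θ => (∫ r in Ioi (0:ℝ), Phi k α x θ r).re) (fun _ => 0) hpi
    (Complex.continuous_re.comp_continuousOn hcont)
    (fun θ hθ => by
      exact hasDerivAt_re (hder θ hθ))
  rw [eq_comm, div_eq_zero_iff] at h
  rcases h with h | h
  · linarith
  · linarith

lemma exp_sub_one (w : ℂ) (hw : 0 ≤ w.re) : ‖Complex.exp (-w) - 1‖ ≤ 2 * ‖w‖ := by
  by_cases h : ‖w‖ ≤ 1
  · simpa using Complex.norm_exp_sub_one_le (x := -w) (by simpa using h)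
  · have : ‖Complex.exp (-w)‖ ≤ 1 := by
      rw [Complex.norm_exp]; simpa using hw
    have h2 := norm_sub_le (Complex.exp (-w)) 1
    rw [norm_one] at h2
    push Not at h
    linarith

/-- The main term, which is purely imaginary. -/
noncomputable def Phi1 (k : ℕ) (x θ r : ℝ) : ℂ :=
  Complex.I ^ k * Complex.exp (Complex.I * (k + 1) * θ) *
    ((r : ℂ) ^ k * Complex.exp (-(-(Complex.I * Complex.exp (Complex.I * θ) * x) * r)))

lemma spos : 0 < Real.sin (Real.pi / 8) :=
  Real.sin_pos_of_pos_of_lt_pi (by positivity) (by linarith [Real.pi_pos])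

lemma re_a {x : ℝ} (θ : ℝ) :
    (-(Complex.I * Complex.exp (Complex.I * θ) * x)).re = x * Real.sin θ := by
  rw [Complex.neg_re, Complex.re_mul_ofReal, Complex.I_mul_re, im_expI]; ring

lemma integral_Phi1 {x : ℝ} (k : ℕ) (hx : 0 < x) :
    (∫ r in Ioi (0:ℝ), Phi1 k x (Real.pi / 8) r).re = 0 := by
  unfold Phi1
  rw [integral_const_mul, integral_cpow_exp k _ (by rw [re_a]; exact mul_pos hx spos)]
  set θ := Real.pi / 8
  have h1 : Complex.exp (Complex.I * (k + 1) * θ) = Complex.exp (Complex.I * θ) ^ (k + 1) := by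
    rw [← Complex.exp_nat_mul]; congr 1; push_cast; ring
  have h2 := Complex.exp_ne_zero (Complex.I * θ)
  have h3 := Complex.I_ne_zero
  have hx' : (x : ℂ) ≠ 0 := by exact_mod_cast hx.ne'
  have : Complex.I ^ k * Complex.exp (Complex.I * (k + 1) * θ) *
    (k.factorial / (-(Complex.I * Complex.exp (Complex.I * θ) * x)) ^ (k + 1)) =
    (((-1) ^ k * k.factorial / x ^ (k + 1) : ℝ) : ℂ) * Complex.I := by
    rw [h1, neg_pow, mul_pow, mul_pow, pow_succ Complex.I]
    push_cast
    have h4 : ((-1 : ℂ) ^ k) * (-1) ^ k = 1 := by rw [← mul_pow]; simp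
    rw [pow_succ (-1 : ℂ)]
    have h5 : ((-1 : ℂ) ^ k) ≠ 0 := by simp
    field_simp
    have h6 : ((-1 : ℂ) ^ k) ^ 2 = 1 := by rw [pow_two, h4]
    simp [h6]
  rw [this, Complex.re_ofReal_mul, Complex.I_re, mul_zero]

lemma Phi_sub {x α r θ : ℝ} (k : ℕ) (hr : 0 < r) (hc : 0 ≤ Real.cos (α * θ)) :
    ‖Phi k α x θ r - Phi1 k x θ r‖ ≤
      2 * (r ^ (((k : ℝ) + α + 1) - 1) * Real.exp (-(x * Real.sin θ * r))) := by
  have e : Phi k α x θ r - Phi1 k x θ r = Phi1 k x θ r *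
      (Complex.exp (-(((r ^ α : ℝ) : ℂ) * Complex.exp (Complex.I * α * θ))) - 1) := by
    unfold Phi Phi1
    rw [sub_eq_add_neg (Complex.I * r * _ * _), Complex.exp_add]
    ring_nf
  have hr' : 0 ≤ r ^ α := Real.rpow_nonneg hr.le _
  have h2 : Complex.I * (α : ℂ) * (θ : ℂ) = Complex.I * ((α * θ : ℝ) : ℂ) := by
    push_cast; ring
  have h1 : Complex.I * (k + 1) * (θ : ℂ) = Complex.I * (((k + 1) * θ : ℝ) : ℂ) := by
    push_cast; ring
  have h3 := exp_sub_one (((r ^ α : ℝ) : ℂ) * Complex.exp (Complex.I * α * θ)) (by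
    rw [h2, Complex.re_ofReal_mul, re_expI]; positivity)
  have h4 : ‖((r ^ α : ℝ) : ℂ) * Complex.exp (Complex.I * α * θ)‖ = r ^ α := by
    rw [h2, norm_mul, norm_expI, Complex.norm_real, Real.norm_of_nonneg hr', mul_one]
  have h5 : ‖Phi1 k x θ r‖ = r ^ k * Real.exp (-(x * Real.sin θ * r)) := by
    unfold Phi1
    rw [h1, norm_mul, norm_mul, norm_mul, norm_expI, norm_pow, norm_pow, Complex.norm_I,
      Complex.norm_real, Real.norm_of_nonneg hr.le, Complex.norm_exp, Complex.neg_re,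
      Complex.re_mul_ofReal, re_a]
    simp
  rw [e, norm_mul, h5]
  rw [h4] at h3
  refine (mul_le_mul_of_nonneg_left h3 (by positivity)).trans (le_of_eq ?_)
  rw [add_sub_cancel_right, Real.rpow_add hr, Real.rpow_natCast]
  ring

lemma decay {α x : ℝ} (k : ℕ) (hα : 1 < α) (hα' : α ≤ 2) (hx : 0 < x) :
    |(∫ r in Ioi (0:ℝ), Phi k α x 0 r).re| ≤
      2 * ((1 / (x * Real.sin (Real.pi / 8))) ^ ((k : ℝ) + α + 1) *
        Real.Gamma ((k : ℝ) + α + 1)) := by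
  have hpi := Real.pi_pos
  have hk : (0:ℝ) ≤ k := Nat.cast_nonneg k
  have hxs := mul_pos hx spos
  have i1 := integrable_Phi (θ := Real.pi / 8) k hα hα' (Or.inl hx.le) (by positivity) le_rfl
  have i2 : IntegrableOn (Phi1 k x (Real.pi / 8)) (Ioi 0) :=
    (integrable_cpow_exp k _ (by rw [re_a]; exact hxs)).const_mul _
  have i3 : IntegrableOn (fun r : ℝ => r ^ (((k : ℝ) + α + 1) - 1) *
      Real.exp (-(x * Real.sin (Real.pi / 8) * r))) (Ioi 0) := by
    have := integrableOn_rpow_mul_exp_neg_mul_rpow (p := 1) (s := ((k : ℝ) + α + 1) - 1)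
      (by linarith) one_pos hxs
    simpa using this
  have hz : (∫ r in Ioi (0:ℝ), (Phi k α x (Real.pi / 8) r - Phi1 k x (Real.pi / 8) r)).re =
      (∫ r in Ioi (0:ℝ), Phi k α x (Real.pi / 8) r).re := by
    rw [integral_sub i1 i2, Complex.sub_re, integral_Phi1 k hx, sub_zero]
  rw [rotate k hα hα' hx.le, ← hz]
  refine (Complex.abs_re_le_norm _).trans ?_
  rw [← Real.integral_rpow_mul_exp_neg_mul_Ioi (by linarith) hxs, ← integral_const_mul]
  refine norm_integral_le_of_norm_le (i3.const_mul 2) ?_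
  exact (ae_restrict_iff' measurableSet_Ioi).2 (Filter.Eventually.of_forall fun r hr =>
    Phi_sub k hr (cpos.le.trans (cos_bound hα hα' (by positivity) le_rfl)))

lemma bounded {α : ℝ} (x : ℝ) (k : ℕ) (hα : 1 < α) (hα' : α ≤ 2) :
    |(∫ r in Ioi (0:ℝ), Phi k α x 0 r).re| ≤
      ∫ r in Ioi (0:ℝ), r ^ k * Real.exp (-Real.cos (Real.pi / 4) * r ^ α) := by
  refine (Complex.abs_re_le_norm _).trans ?_
  refine norm_integral_le_of_norm_le (integrable_pow_exp_rpow k α _ (by linarith) cpos) ?_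
  exact (ae_restrict_iff' measurableSet_Ioi).2 (Filter.Eventually.of_forall fun r hr =>
    Phi_le k hα hα' (Or.inr rfl) le_rfl (by positivity) hr)

lemma hasDerivAt_J {α : ℝ} (x : ℝ) (k : ℕ) (hα : 1 < α) (hα' : α ≤ 2) :
    HasDerivAt (fun x => (∫ r in Ioi (0:ℝ), Phi k α x 0 r).re)
      (∫ r in Ioi (0:ℝ), Phi (k + 1) α x 0 r).re x := by
  have h := (hasDerivAt_integral_of_dominated_loc_of_deriv_le (𝕜 := ℝ)
      (μ := volume.restrict (Ioi (0:ℝ))) (F := fun x r => Phi k α x 0 r)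
      (F' := fun x r => Phi (k + 1) α x 0 r) (x₀ := x)
      (bound := fun r => r ^ (k + 1) * Real.exp (-Real.cos (Real.pi / 4) * r ^ α))
      Filter.univ_mem
      (Filter.Eventually.of_forall fun θ => aesm_Phi _ _ _ _)
      (integrable_Phi k hα hα' (Or.inr rfl) le_rfl (by positivity))
      (aesm_Phi _ _ _ _)
      ((ae_restrict_iff' measurableSet_Ioi).2 (Filter.Eventually.of_forall fun r hr t _ =>
        Phi_le (k + 1) hα hα' (Or.inr rfl) le_rfl (by positivity) hr))
      (integrable_pow_exp_rpow (k + 1) α _ (by linarith) cpos)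
      (Filter.Eventually.of_forall fun r t _ => ?_)).2
  · exact hasDerivAt_re h
  · unfold Phi
    have h0 : HasDerivAt (fun x : ℝ => (x : ℂ)) 1 t := Complex.ofRealCLM.hasDerivAt
    have := (((h0.const_mul (Complex.I * r * Complex.exp (Complex.I * (0:ℝ)))).sub_const
      (((r ^ α : ℝ) : ℂ) * Complex.exp (Complex.I * α * (0:ℝ)))).cexp).const_mul
      (Complex.I ^ k * Complex.exp (Complex.I * (k + 1) * (0:ℝ)) * (r : ℂ) ^ k)
    refine this.congr_deriv ?_
    simp
    ring


lemma GKernel_eq {α : ℝ} (hα : 1 < α) (hα' : α ≤ 2) :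
    GKernel α = fun x => (1 / Real.pi) * (∫ r in Ioi (0:ℝ), Phi 0 α x 0 r).re := by
  funext x
  have hi := integrable_Phi (x := x) (θ := 0) 0 hα hα' (Or.inr rfl) le_rfl (by positivity)
  have h1 : (∫ r in Ioi (0:ℝ), Phi 0 α x 0 r).re = ∫ r in Ioi (0:ℝ), (Phi 0 α x 0 r).re :=
    (integral_re hi).symm
  have h2 : ∀ r : ℝ, (Phi 0 α x 0 r).re = Real.exp (-(r ^ α)) * Real.cos (r * x) := by
    intro r
    simp [Phi, Complex.exp_re]
  have h3 : ∀ ξ : ℝ, (Complex.exp (-(Complex.I * (ξ : ℂ) * (x : ℂ)) - ((|ξ| ^ α : ℝ) : ℂ))).re =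
      (fun r : ℝ => Real.exp (-(r ^ α)) * Real.cos (r * x)) |ξ| := by
    intro ξ
    have : Real.cos (|ξ| * x) = Real.cos (ξ * x) := by
      rw [← Real.cos_abs, ← Real.cos_abs (ξ * x), abs_mul, abs_mul, abs_abs]
    simp only [this]
    simp [Complex.exp_re]
  unfold GKernel
  rw [h1]
  simp only [h2, h3]
  rw [integral_comp_abs (f := fun r : ℝ => Real.exp (-(r ^ α)) * Real.cos (r * x))]
  rw [← mul_assoc]
  congr 1
  field_simp

lemma iteratedDeriv_GKernel {α : ℝ} (hα : 1 < α) (hα' : α ≤ 2) (k : ℕ) :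
    iteratedDeriv k (GKernel α) =
      fun x => (1 / Real.pi) * (∫ r in Ioi (0:ℝ), Phi k α x 0 r).re := by
  induction k with
  | zero => rw [iteratedDeriv_zero, GKernel_eq hα hα']
  | succ k ih =>
    rw [iteratedDeriv_succ, ih]
    funext x
    exact ((hasDerivAt_J x k hα hα').const_mul _).deriv

lemma GKernel_neg (α : ℝ) : (fun x => GKernel α (-x)) = GKernel α := by
  funext x
  unfold GKernel
  simp [Complex.exp_re]

lemma abs_iteratedDeriv_neg (α : ℝ) (k : ℕ) (x : ℝ) :
    |iteratedDeriv k (GKernel α) (-x)| = |iteratedDeriv k (GKernel α) x| := by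
  have := iteratedDeriv_comp_neg k (GKernel α) x
  rw [GKernel_neg] at this
  rw [this]
  simp [abs_mul]

/-- Polynomial decay of all derivatives of `G`:
for `α ∈ (1,2]` and `k ∈ ℕ` there is `C = C(α,k) > 0` with
`|D^k G(x)| ≤ C / (1 + |x|^{1+α+k})` for all `x`. -/
theorem deriv_GKernel_decay (α : ℝ) (hα : 1 < α) (hα' : α ≤ 2) (k : ℕ) :
    ∃ C : ℝ, 0 < C ∧
      ∀ x : ℝ, |iteratedDeriv k (GKernel α) x| ≤ C / (1 + |x| ^ (1 + α + (k : ℝ))) := by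
  have hk : (0:ℝ) ≤ k := Nat.cast_nonneg k
  have hpi := Real.pi_pos
  obtain ⟨M, hM⟩ : ∃ M, M = ∫ r in Ioi (0:ℝ),
    r ^ k * Real.exp (-Real.cos (Real.pi / 4) * r ^ α) := ⟨_, rfl⟩
  obtain ⟨N, hN⟩ : ∃ N, N = 2 * ((1 / Real.sin (Real.pi / 8)) ^ ((k : ℝ) + α + 1) *
        Real.Gamma ((k : ℝ) + α + 1)) := ⟨_, rfl⟩
  have hNpos : 0 < N := by
    have := Real.Gamma_pos_of_pos (s := (k : ℝ) + α + 1) (by linarith)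
    have := spos
    rw [hN]; positivity
  have hMnn : 0 ≤ M := hM ▸ (abs_nonneg _).trans (bounded 0 k hα hα')
  refine ⟨1 / Real.pi * (M + N), by positivity, ?_⟩
  -- it is enough to treat nonnegative arguments
  suffices H : ∀ x : ℝ, 0 ≤ x → |iteratedDeriv k (GKernel α) x| ≤
      1 / Real.pi * (M + N) / (1 + |x| ^ (1 + α + (k : ℝ))) by
    intro x
    rcases le_total 0 x with hx | hx
    · exact H x hx
    · rw [← abs_iteratedDeriv_neg, ← abs_neg x]
      exact H (-x) (by linarith)
  intro x hx
  have hp : 0 ≤ |x| ^ (1 + α + (k : ℝ)) := by positivity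
  rw [le_div_iff₀ (by positivity), iteratedDeriv_GKernel hα hα', abs_mul,
    abs_of_pos (by positivity : 0 < 1 / Real.pi), mul_assoc]
  refine mul_le_mul_of_nonneg_left ?_ (by positivity)
  rw [mul_add, mul_one]
  refine add_le_add ((bounded x k hα hα').trans_eq hM.symm) ?_
  rcases hx.eq_or_lt with rfl | hx
  · rw [abs_zero, Real.zero_rpow (by linarith), mul_zero]
    exact hNpos.le
  · refine (mul_le_mul_of_nonneg_right (decay k hα hα' hx) hp).trans_eq ?_
    have e : 1 + α + (k : ℝ) = (k : ℝ) + α + 1 := by ring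
    have e2 : (1 / (x * Real.sin (Real.pi / 8))) = x⁻¹ * (1 / Real.sin (Real.pi / 8)) := by
      rw [one_div, mul_inv, one_div]
    have hs := spos
    rw [abs_of_pos hx, e, hN, e2, Real.mul_rpow (by positivity) (by positivity),
      Real.inv_rpow hx.le]
    have : x ^ ((k : ℝ) + α + 1) ≠ 0 := (Real.rpow_pos_of_pos hx _).ne'
    field_simp
end

section
/- Let α ∈ (1,2), β ∈ (0,1) with α + β ∈ (2,3), let X be a real Banach space, and let φ : ℝ → ℝ be a smooth compactly supported function. Then there exists a constant C = C(α,β,φ) > 0 such that for every bounded, twice continuously differentiable u : ℝ → X with bounded derivatives and finite seminorm [D²u]_{α+β−2}, the commutator satisfies sup_x ‖(−Δ)^{α/2}(φu)(x) − φ(x)·(−Δ)^{α/2}u(x)‖ + sup_{x≠y} ‖[(−Δ)^{α/2}(φu) − φ·(−Δ)^{α/2}u](x) − [(−Δ)^{α/2}(φu) − φ·(−Δ)^{α/2}u](y)‖ / |x−y|^β ≤ C ( sup_x ‖u(x)‖ + sup_x ‖Du(x)‖ + [u]_β + [Du]_β ), where (−Δ)^{α/2}w(x) := C_α ∫_ℝ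 ( w(x) − w(y) − Dw(x)·(x−y) ) / |x−y|^{1+α} dy (a Bochner integral, which converges absolutely for both w = u and w = φu under the stated hypotheses). -/
open MeasureTheory

/-- The normalizing constant `C_α = 2^α Γ((1+α)/2) / (π^{1/2} Γ(−α/2))`. -/
noncomputable def Calpha (α : ℝ) : ℝ :=
  2 ^ α * Real.Gamma ((1 + α) / 2) / (Real.sqrt Real.pi * Real.Gamma (-(α / 2)))

/-- Sup norm `sup_x ‖φ(x)‖` of a Banach-space-valued function. -/
noncomputable def supNorm {X : Type*} [NormedAddCommGroup X] (φ : ℝ → X) : ℝ :=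
  ⨆ x : ℝ, ‖φ x‖

/-- The `β`-Hölder seminorm `[φ]_β = sup_{x≠y} ‖φ(x) − φ(y)‖ / |x−y|^β`. -/
noncomputable def holderSemi {X : Type*} [NormedAddCommGroup X] (β : ℝ) (φ : ℝ → X) : ℝ :=
  ⨆ p : {q : ℝ × ℝ // q.1 ≠ q.2}, ‖φ p.val.1 - φ p.val.2‖ / |p.val.1 - p.val.2| ^ β

/-- The fractional Laplacian (pointwise/Bochner form)
`(−Δ)^{α/2}w(x) = C_α ∫_ℝ (w(x) − w(y) − Dw(x)·(x−y)) / |x−y|^{1+α} dy`. -/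
noncomputable def fracLap (α : ℝ) {X : Type*} [NormedAddCommGroup X] [NormedSpace ℝ X]
    (w : ℝ → X) (x : ℝ) : X :=
  Calpha α • ∫ y : ℝ, (|x - y| ^ (1 + α))⁻¹ • (w x - w y - (x - y) • deriv w x)

/-- kernel times min -/
lemma kernel_integrable (α : ℝ) (hα : 1 < α) (hα2 : α < 2) :
    Integrable (fun h : ℝ => (|h| ^ (1 + α))⁻¹ * min |h| (h ^ 2)) := by
  have hm : Measurable (fun h : ℝ => (|h| ^ (1 + α))⁻¹ * min |h| (h ^ 2)) := by
    fun_prop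
  have h1 : IntegrableOn (fun h : ℝ => (|h| ^ (1 + α))⁻¹ * min |h| (h ^ 2)) (Set.Ioc 0 1) := by
    have : IntegrableOn (fun h : ℝ => h ^ (1 - α)) (Set.Ioc 0 1) := by
      rw [← intervalIntegrable_iff_integrableOn_Ioc_of_le zero_le_one]
      exact intervalIntegral.intervalIntegrable_rpow' (by linarith)
    refine Integrable.mono' this hm.aestronglyMeasurable ?_
    refine (ae_restrict_mem measurableSet_Ioc).mono ?_
    intro h hh
    have h0 : 0 < h := hh.1
    rw [Real.norm_of_nonneg (by positivity), abs_of_pos h0]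
    calc (h ^ (1 + α))⁻¹ * min h (h ^ 2) ≤ (h ^ (1 + α))⁻¹ * h ^ 2 := by
          gcongr; exact min_le_right _ _
      _ = h ^ (1 - α) := by
          rw [← Real.rpow_neg h0.le, ← Real.rpow_natCast, ← Real.rpow_add h0]
          congr 1; push_cast; ring
  have h2 : IntegrableOn (fun h : ℝ => (|h| ^ (1 + α))⁻¹ * min |h| (h ^ 2)) (Set.Ioi 1) := by
    have : IntegrableOn (fun h : ℝ => h ^ (-α)) (Set.Ioi 1) :=
      integrableOn_Ioi_rpow_of_lt (by linarith) one_pos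
    refine Integrable.mono' this hm.aestronglyMeasurable ?_
    refine (ae_restrict_mem measurableSet_Ioi).mono ?_
    intro h hh
    have h0 : 0 < h := lt_trans one_pos hh
    rw [Real.norm_of_nonneg (by positivity), abs_of_pos h0]
    calc (h ^ (1 + α))⁻¹ * min h (h ^ 2) ≤ (h ^ (1 + α))⁻¹ * h := by
          gcongr; exact min_le_left _ _
      _ = h ^ (-α) := by
          nth_rw 2 [← Real.rpow_one h]
          rw [← Real.rpow_neg h0.le, ← Real.rpow_add h0]
          congr 1; ring
  have h3 : IntegrableOn (fun h : ℝ => (|h| ^ (1 + α))⁻¹ * min |h| (h ^ 2)) (Set.Ioi 0) := by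
    rw [← Set.Ioc_union_Ioi_eq_Ioi (zero_le_one : (0:ℝ) ≤ 1)]
    exact h1.union h2
  have h4 : IntegrableOn (fun h : ℝ => (|h| ^ (1 + α))⁻¹ * min |h| (h ^ 2)) (Set.Iic 0) := by
    rw [← neg_zero, ← integrableOn_Ici_iff_integrableOn_Ioi] at *
    have := h3.comp_neg
    simpa using this
  rw [← integrableOn_univ, ← Set.Iic_union_Ioi (a := (0:ℝ))]
  exact h4.union h3

lemma mvt_bound {E : Type*} [NormedAddCommGroup E] [NormedSpace ℝ E] {f f' : ℝ → E} {K : ℝ}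
    (hf : ∀ x, HasDerivAt f (f' x) x) (hK : ∀ x, ‖f' x‖ ≤ K) (x y : ℝ) :
    ‖f x - f y‖ ≤ K * |x - y| := by
  have := Convex.norm_image_sub_le_of_norm_hasDerivWithin_le (s := Set.univ) (x := y) (y := x)
    (fun z _ => (hf z).hasDerivWithinAt) (fun z _ => hK z) convex_univ trivial trivial
  simpa [Real.norm_eq_abs] using this

lemma holder_of_lip {E : Type*} [NormedAddCommGroup E] [NormedSpace ℝ E] {f f' : ℝ → E} {K : ℝ}
    {β : ℝ} (hβ : 0 < β) (hβ1 : β < 1)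
    (hf : ∀ x, HasDerivAt f (f' x) x) (h0 : ∀ x, ‖f x‖ ≤ K) (hK : ∀ x, ‖f' x‖ ≤ K) (x y : ℝ) :
    ‖f x - f y‖ ≤ 2 * K * |x - y| ^ β := by
  have K0 : 0 ≤ K := (norm_nonneg _).trans (h0 0)
  rcases le_total |x - y| 1 with h | h
  · have h1 := mvt_bound hf hK x y
    have h2 : |x - y| ≤ |x - y| ^ β := by
      rcases eq_or_lt_of_le (abs_nonneg (x - y)) with h' | h'
      · rw [← h', Real.zero_rpow hβ.ne']
      · have := Real.rpow_le_rpow_of_exponent_ge h' h hβ1.le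
        simpa using this
    nlinarith [mul_le_mul_of_nonneg_left h2 K0, mul_nonneg K0 (abs_nonneg (x-y))]
  · have h1 : ‖f x - f y‖ ≤ K + K := (norm_sub_le _ _).trans (add_le_add (h0 x) (h0 y))
    have h2 : 1 ≤ |x - y| ^ β := Real.one_le_rpow h hβ.le
    nlinarith [mul_le_mul_of_nonneg_left h2 K0]

lemma taylor_bound {E : Type*} [NormedAddCommGroup E] [NormedSpace ℝ E] {f f' f'' : ℝ → E} {K : ℝ}
    (hf : ∀ x, HasDerivAt f (f' x) x) (hf' : ∀ x, HasDerivAt f' (f'' x) x)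
    (h1 : ∀ x, ‖f' x‖ ≤ K) (h2 : ∀ x, ‖f'' x‖ ≤ K) (x h : ℝ) :
    ‖f x - f (x - h) - h • f' x‖ ≤ 2 * K * min |h| (h ^ 2) := by
  have K0 : 0 ≤ K := (norm_nonneg _).trans (h1 0)
  rw [mul_min_of_nonneg _ _ (by positivity)]
  refine le_min ?_ ?_
  · have a := mvt_bound hf h1 x (x - h)
    rw [sub_sub_cancel] at a
    have b : ‖h • f' x‖ ≤ |h| * K := by
      rw [norm_smul, Real.norm_eq_abs]; gcongr; exact h1 x
    refine (norm_sub_le _ _).trans ?_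
    linarith
  · have key := Convex.norm_image_sub_le_of_norm_hasDerivWithin_le
      (f := fun t => f t - t • f' x) (f' := fun t => f' t - (1:ℝ) • f' x) (C := K * |h|)
      (s := Set.uIcc (x - h) x) (x := x - h) (y := x)
      (fun z _ => ((hf z).sub ((hasDerivAt_id z).smul_const (f' x))).hasDerivWithinAt)
      (by
        intro z hz
        rw [one_smul]
        refine (mvt_bound hf' h2 z x).trans ?_
        have := Set.abs_sub_right_of_mem_uIcc hz
        rw [sub_sub_cancel, abs_sub_comm] at this
        exact mul_le_mul_of_nonneg_left this K0)
      (convex_uIcc _ _) Set.left_mem_uIcc Set.right_mem_uIcc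
    have e : f x - x • f' x - (f (x - h) - (x - h) • f' x) = f x - f (x - h) - h • f' x := by
      rw [sub_smul]; abel
    rw [e, sub_sub_cancel, Real.norm_eq_abs, mul_assoc, abs_mul_abs_self, ← sq] at key
    nlinarith [mul_nonneg K0 (sq_nonneg h)]

/-- increments bound -/
lemma incr_bound {E : Type*} [NormedAddCommGroup E] [NormedSpace ℝ E] {f f' : ℝ → E} {K : ℝ}
    (hf : ∀ x, HasDerivAt f (f' x) x) (hL : ∀ x, ‖f x‖ ≤ K) 
    (h1 : ∀ x, ‖f' x‖ ≤ K) (x h : ℝ) :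
    |h| * ‖f x - f (x - h)‖ ≤ 2 * K * min |h| (h ^ 2) := by
  have K0 : 0 ≤ K := (norm_nonneg _).trans (h1 0)
  rw [mul_min_of_nonneg _ _ (by positivity)]
  refine le_min ?_ ?_
  · have : ‖f x - f (x - h)‖ ≤ K + K := (norm_sub_le _ _).trans (add_le_add (hL _) (hL _))
    nlinarith [mul_le_mul_of_nonneg_left this (abs_nonneg h)]
  · have a := mvt_bound hf h1 x (x - h)
    rw [sub_sub_cancel] at a
    have := mul_le_mul_of_nonneg_left a (abs_nonneg h)
    nlinarith [mul_nonneg K0 (sq_nonneg h), sq_abs h]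

section
variable {X : Type*} [NormedAddCommGroup X] [NormedSpace ℝ X]

/-- The commutator integrand. -/
noncomputable def FF (φ φ' : ℝ → ℝ) (u : ℝ → X) (x h : ℝ) : X :=
  (φ x - φ (x - h) - h * φ' x) • u (x - h) - (h * φ' x) • (u x - u (x - h))

lemma FF_bound {φ φ' φ'' : ℝ → ℝ} {u u' : ℝ → X} {M N : ℝ}
    (hφ : ∀ x, HasDerivAt φ (φ' x) x) (hφ' : ∀ x, HasDerivAt φ' (φ'' x) x)
    (m1 : ∀ x, ‖φ' x‖ ≤ M) (m2 : ∀ x, ‖φ'' x‖ ≤ M)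
    (hu : ∀ x, HasDerivAt u (u' x) x) (n0 : ∀ x, ‖u x‖ ≤ N) (n1 : ∀ x, ‖u' x‖ ≤ N) (x h : ℝ) :
    ‖FF φ φ' u x h‖ ≤ 4 * M * N * min |h| (h ^ 2) := by
  have M0 : 0 ≤ M := (norm_nonneg _).trans (m1 0)
  have N0 : 0 ≤ N := (norm_nonneg _).trans (n0 0)
  have a := taylor_bound hφ hφ' m1 m2 x h
  have b := incr_bound hu n0 n1 x h
  rw [smul_eq_mul] at a
  have A : ‖(φ x - φ (x - h) - h * φ' x) • u (x - h)‖ ≤ 2 * M * min |h| (h ^ 2) * N := by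
    rw [norm_smul]; gcongr; exact n0 _
  have B : ‖(h * φ' x) • (u x - u (x - h))‖ ≤ M * (2 * N * min |h| (h ^ 2)) := by
    rw [norm_smul, norm_mul, Real.norm_eq_abs h, mul_comm |h|, mul_assoc]; gcongr; exact m1 _
  refine (norm_sub_le _ _).trans ?_
  linarith

lemma FF_holder {φ φ' φ'' φ''' : ℝ → ℝ} {u u' : ℝ → X} {M N β : ℝ} (hβ : 0 < β) (hβ1 : β < 1)
    (hφ : ∀ x, HasDerivAt φ (φ' x) x) (hφ' : ∀ x, HasDerivAt φ' (φ'' x) x)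
    (hφ'' : ∀ x, HasDerivAt φ'' (φ''' x) x)
    (m1 : ∀ x, ‖φ' x‖ ≤ M) (m2 : ∀ x, ‖φ'' x‖ ≤ M) (m3 : ∀ x, ‖φ''' x‖ ≤ M)
    (hu : ∀ x, HasDerivAt u (u' x) x) (n0 : ∀ x, ‖u x‖ ≤ N) (n1 : ∀ x, ‖u' x‖ ≤ N)
    (k0 : ∀ x y, ‖u x - u y‖ ≤ N * |x - y| ^ β) (k1 : ∀ x y, ‖u' x - u' y‖ ≤ N * |x - y| ^ β)
    (x y h : ℝ) :
    ‖FF φ φ' u x h - FF φ φ' u y h‖ ≤ 12 * M * N * |x - y| ^ β * min |h| (h ^ 2) := by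
  have M0 : 0 ≤ M := (norm_nonneg _).trans (m1 0)
  have N0 : 0 ≤ N := (norm_nonneg _).trans (n0 0)
  set d := |x - y| ^ β with hd
  have d0 : 0 ≤ d := by positivity
  set m := min |h| (h ^ 2) with hm
  have hm0 : 0 ≤ m := by positivity
  -- A
  have a := taylor_bound hφ hφ' m1 m2
  have a' := taylor_bound hφ' hφ'' m2 m3
  simp only [smul_eq_mul] at a a'
  have aa := holder_of_lip (f := fun x => φ x - φ (x - h) - h * φ' x)
    (f' := fun x => φ' x - φ' (x - h) - h * φ'' x) hβ hβ1
    (fun z => ((hφ z).sub ((hφ (z - h)).comp_sub_const z h)).sub ((hφ' z).const_mul h))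
    (fun z => a z h) (fun z => a' z h) x y
  have bb := holder_of_lip hβ hβ1 hφ' m1 m2 x y
  have b := incr_bound hu n0 n1 x h
  have c : |h| * ‖(u x - u (x - h)) - (u y - u (y - h))‖ ≤ 2 * N * d * m := by
    rw [hm, mul_min_of_nonneg _ _ (by positivity)]
    refine le_min ?_ ?_
    · have e : (u x - u (x - h)) - (u y - u (y - h)) = (u x - u y) - (u (x - h) - u (y - h)) := by
        abel
      have k := k0 (x - h) (y - h)
      rw [sub_sub_sub_cancel_right] at k
      have : ‖(u x - u (x - h)) - (u y - u (y - h))‖ ≤ N * d + N * d := by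
        rw [e]; exact (norm_sub_le _ _).trans (add_le_add (k0 x y) k)
      nlinarith [mul_le_mul_of_nonneg_left this (abs_nonneg h)]
    · have := mvt_bound (f := fun t => u (x - t) - u (y - t))
        (f' := fun t => -u' (x - t) - -u' (y - t)) (K := N * d)
        (fun t => ((hu (x - t)).comp_const_sub x t).sub ((hu (y - t)).comp_const_sub y t))
        (by
          intro t
          have k := k1 (y - t) (x - t)
          rw [sub_sub_sub_cancel_right, abs_sub_comm] at k
          rw [neg_sub_neg]; exact k) 0 h
      simp only [sub_zero, zero_sub, abs_neg] at this
      have e : (u x - u (x - h)) - (u y - u (y - h)) = u x - u y - (u (x - h) - u (y - h)) := by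
        abel
      rw [e]
      have e1 := mul_le_mul_of_nonneg_left this (abs_nonneg h)
      have e2 : |h| * (N * d * |h|) = N * d * h ^ 2 := by rw [← sq_abs h]; ring
      have e3 := mul_nonneg (mul_nonneg N0 d0) (sq_nonneg h)
      linarith
  have split : FF φ φ' u x h - FF φ φ' u y h =
      ((φ x - φ (x - h) - h * φ' x) - (φ y - φ (y - h) - h * φ' y)) • u (x - h)
      + (φ y - φ (y - h) - h * φ' y) • (u (x - h) - u (y - h))
      - (h * (φ' x - φ' y)) • (u x - u (x - h))
      - (h * φ' y) • ((u x - u (x - h)) - (u y - u (y - h))) := by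
    unfold FF; module
  have T1 : ‖((φ x - φ (x - h) - h * φ' x) - (φ y - φ (y - h) - h * φ' y)) • u (x - h)‖
      ≤ 2 * (2 * M * m) * d * N := by
    rw [norm_smul]; gcongr; exact n0 _
  have T2 : ‖(φ y - φ (y - h) - h * φ' y) • (u (x - h) - u (y - h))‖ ≤ 2 * M * m * (N * d) := by
    have k := k0 (x - h) (y - h)
    rw [sub_sub_sub_cancel_right] at k
    rw [norm_smul]; gcongr; exact a y h
  have T3 : ‖(h * (φ' x - φ' y)) • (u x - u (x - h))‖ ≤ 2 * M * d * (2 * N * m) := by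
    rw [norm_smul, norm_mul, Real.norm_eq_abs h, mul_comm |h|, mul_assoc]; gcongr
  have T4 : ‖(h * φ' y) • ((u x - u (x - h)) - (u y - u (y - h)))‖ ≤ M * (2 * N * d * m) := by
    rw [norm_smul, norm_mul, Real.norm_eq_abs h, mul_comm |h|, mul_assoc]; gcongr; exact m1 _
  rw [split]
  have := norm_sub_le_of_le (norm_sub_le_of_le (norm_add_le_of_le T1 T2) T3) T4
  linarith
end

lemma ker_integrable {X : Type*} [NormedAddCommGroup X] [NormedSpace ℝ X] {α : ℝ} (hα : 1 < α)
    (hα2 : α < 2) {g : ℝ → X} (hg : Continuous g) {K : ℝ}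
    (hK : ∀ h, ‖g h‖ ≤ K * min |h| (h ^ 2)) :
    Integrable (fun h : ℝ => (|h| ^ (1 + α))⁻¹ • g h) ∧
    ‖∫ h : ℝ, (|h| ^ (1 + α))⁻¹ • g h‖ ≤
      K * ∫ h : ℝ, (|h| ^ (1 + α))⁻¹ * min |h| (h ^ 2) := by
  have I := (kernel_integrable α hα hα2).const_mul K
  have hb : ∀ h : ℝ, ‖(|h| ^ (1 + α))⁻¹ • g h‖ ≤ K * ((|h| ^ (1 + α))⁻¹ * min |h| (h ^ 2)) := by
    intro h
    rw [norm_smul, Real.norm_of_nonneg (by positivity)]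
    calc _ ≤ (|h| ^ (1 + α))⁻¹ * (K * min |h| (h ^ 2)) := by gcongr; exact hK h
      _ = _ := by ring
  constructor
  · refine Integrable.mono' I ?_ (Filter.Eventually.of_forall hb)
    have : Measurable (fun h : ℝ => (|h| ^ (1 + α))⁻¹) := by fun_prop
    exact this.aestronglyMeasurable.smul hg.aestronglyMeasurable
  · rw [← integral_const_mul]
    exact norm_integral_le_of_norm_le I (Filter.Eventually.of_forall hb)

lemma compact_bound {f : ℝ → ℝ} (hf : Continuous f) (hc : HasCompactSupport f) :
    ∃ M, ∀ x, ‖f x‖ ≤ M := hf.bounded_above_of_compact_support hc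

lemma holderSemi_bdd {X : Type*} [NormedAddCommGroup X] {β K : ℝ} {f : ℝ → X} (hβ : 0 < β)
    (h : ∀ x y, ‖f x - f y‖ ≤ K * |x - y| ^ β) (x y : ℝ) :
    ‖f x - f y‖ ≤ holderSemi β f * |x - y| ^ β := by
  rcases eq_or_ne x y with rfl | hxy
  · simp [Real.zero_rpow hβ.ne']
  · have hp : ∀ x y : ℝ, x ≠ y → 0 < |x - y| ^ β := fun x y hxy =>
      Real.rpow_pos_of_pos (abs_pos.2 (sub_ne_zero.2 hxy)) _
    rw [← div_le_iff₀ (hp x y hxy)]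
    refine le_ciSup (f := fun p : {q : ℝ × ℝ // q.1 ≠ q.2} =>
      ‖f p.val.1 - f p.val.2‖ / |p.val.1 - p.val.2| ^ β) ⟨K, ?_⟩ ⟨(x, y), hxy⟩
    rintro _ ⟨⟨⟨a, b⟩, hp'⟩, rfl⟩
    simp only
    rw [div_le_iff₀ (hp a b hp')]
    exact h a b

/-- Commutator estimate for the fractional Laplacian with a smooth cutoff
(the key bound on the term `K₁` in the freezing-of-coefficients argument):
there is `C = C(α,β,φ) > 0` such that for every bounded `C²` function `u : ℝ → X`
with bounded derivatives and finite seminorm `[D²u]_{α+β−2}`, the Bochner integrals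
defining `(−Δ)^{α/2}u` and `(−Δ)^{α/2}(φu)` converge absolutely, and
`‖(−Δ)^{α/2}(φu) − φ·(−Δ)^{α/2}u‖_∞ + [(−Δ)^{α/2}(φu) − φ·(−Δ)^{α/2}u]_β
  ≤ C (‖u‖_∞ + ‖Du‖_∞ + [u]_β + [Du]_β)`. -/
theorem fracLap_commutator_bound (α β : ℝ) (hα : 1 < α) (hα2 : α < 2)
    (hβ : 0 < β) (hβ1 : β < 1) (hab : 2 < α + β) (hab2 : α + β < 3)
    (X : Type*) [NormedAddCommGroup X] [NormedSpace ℝ X] [CompleteSpace X]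
    (φ : ℝ → ℝ) (hφ : ContDiff ℝ (⊤ : ℕ∞) φ) (hφc : HasCompactSupport φ) :
    ∃ C : ℝ, 0 < C ∧ ∀ u : ℝ → X,
      (∃ B : ℝ, ∀ x : ℝ, ‖u x‖ ≤ B) →
      ContDiff ℝ 2 u →
      (∃ B : ℝ, ∀ x : ℝ, ‖deriv u x‖ ≤ B) →
      (∃ B : ℝ, ∀ x : ℝ, ‖iteratedDeriv 2 u x‖ ≤ B) →
      (∃ B : ℝ, ∀ x y : ℝ, x ≠ y →
        ‖iteratedDeriv 2 u x - iteratedDeriv 2 u y‖ ≤ B * |x - y| ^ (α + β - 2)) →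
      (∀ x : ℝ, Integrable
          (fun y : ℝ => (|x - y| ^ (1 + α))⁻¹ • (u x - u y - (x - y) • deriv u x))) ∧
      (∀ x : ℝ, Integrable
          (fun y : ℝ => (|x - y| ^ (1 + α))⁻¹ •
            (φ x • u x - φ y • u y - (x - y) • deriv (fun z : ℝ => φ z • u z) x))) ∧
      supNorm (fun x : ℝ => fracLap α (fun z : ℝ => φ z • u z) x - φ x • fracLap α u x)
        + holderSemi β
            (fun x : ℝ => fracLap α (fun z : ℝ => φ z • u z) x - φ x • fracLap α u x)
        ≤ C * (supNorm u + supNorm (deriv u) + holderSemi β u + holderSemi β (deriv u)) := by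
  have hd : ∀ n : ℕ, ∀ x, HasDerivAt (iteratedDeriv n φ) (iteratedDeriv (n + 1) φ x) x := by
    intro n x
    rw [iteratedDeriv_succ]
    exact (hφ.differentiable_iteratedDeriv n (by exact_mod_cast WithTop.coe_lt_top _) x).hasDerivAt
  have hbd : ∀ n : ℕ, ∃ M, ∀ x, ‖iteratedDeriv n φ x‖ ≤ M := by
    intro n
    refine compact_bound (hφ.continuous_iteratedDeriv n (by exact_mod_cast le_top)) ?_
    induction n with
    | zero => simpa using hφc
    | succ n ih => rw [iteratedDeriv_succ]; exact ih.deriv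
  choose Mn hMn using hbd
  have hφ1 := hd 0
  have hφ2 := hd 1
  have hφ3 := hd 2
  simp only [iteratedDeriv_zero, zero_add] at hφ1
  simp only [Nat.reduceAdd] at hφ2 hφ3
  obtain ⟨M, M1, M2, M3⟩ : ∃ M, (∀ x, ‖iteratedDeriv 1 φ x‖ ≤ M) ∧
      (∀ x, ‖iteratedDeriv 2 φ x‖ ≤ M) ∧ (∀ x, ‖iteratedDeriv 3 φ x‖ ≤ M) :=
    ⟨max (Mn 1) (max (Mn 2) (Mn 3)), fun x => (hMn 1 x).trans (by simp),
      fun x => (hMn 2 x).trans (by simp), fun x => (hMn 3 x).trans (by simp)⟩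
  have M0 : 0 ≤ M := (norm_nonneg _).trans (M1 0)
  set φ₁ := iteratedDeriv 1 φ
  set φ₂ := iteratedDeriv 2 φ
  set φ₃ := iteratedDeriv 3 φ
  set I := ∫ h : ℝ, (|h| ^ (1 + α))⁻¹ * min |h| (h ^ 2) with hI
  have I0 : 0 ≤ I := integral_nonneg fun h => by positivity
  refine ⟨|Calpha α| * I * 16 * M + 1, by positivity, ?_⟩
  rintro u ⟨B0, hB0⟩ huC ⟨B1, hB1⟩ ⟨B2, hB2⟩ -
  have hu1 : ∀ x, HasDerivAt u (deriv u x) x := fun x =>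
    (huC.differentiable (by norm_num) x).hasDerivAt
  have hu2 : ∀ x, HasDerivAt (deriv u) (iteratedDeriv 2 u x) x := by
    intro x
    have := huC.differentiable_iteratedDeriv 1 (by norm_num) x
    rw [iteratedDeriv_succ]
    rw [iteratedDeriv_one] at *
    exact this.hasDerivAt
  have huc : Continuous u := huC.continuous
  have hφcont : Continuous φ := hφ.continuous
  -- bounds by the norms
  have s0 : ∀ x, ‖u x‖ ≤ supNorm u := fun x =>
    le_ciSup (f := fun x => ‖u x‖) ⟨B0, by rintro _ ⟨z, rfl⟩; exact hB0 z⟩ x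
  have s1 : ∀ x, ‖deriv u x‖ ≤ supNorm (deriv u) := fun x =>
    le_ciSup (f := fun x => ‖deriv u x‖) ⟨B1, by rintro _ ⟨z, rfl⟩; exact hB1 z⟩ x
  have t0 := holderSemi_bdd hβ (holder_of_lip (K := max B0 B1) hβ hβ1 hu1
    (fun x => (hB0 x).trans (le_max_left _ _)) (fun x => (hB1 x).trans (le_max_right _ _)))
  have t1 := holderSemi_bdd hβ (holder_of_lip (K := max B1 B2) hβ hβ1 hu2
    (fun x => (hB1 x).trans (le_max_left _ _)) (fun x => (hB2 x).trans (le_max_right _ _)))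
  have p0 : 0 ≤ supNorm u := Real.iSup_nonneg fun _ => norm_nonneg _
  have p1 : 0 ≤ supNorm (deriv u) := Real.iSup_nonneg fun _ => norm_nonneg _
  have q0 : 0 ≤ holderSemi β u := Real.iSup_nonneg fun _ => by positivity
  have q1 : 0 ≤ holderSemi β (deriv u) := Real.iSup_nonneg fun _ => by positivity
  set N := supNorm u + supNorm (deriv u) + holderSemi β u + holderSemi β (deriv u) with hN
  have N0 : 0 ≤ N := by positivity
  have n0 : ∀ x, ‖u x‖ ≤ N := fun x => (s0 x).trans (by linarith)
  have n1 : ∀ x, ‖deriv u x‖ ≤ N := fun x => (s1 x).trans (by linarith)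
  have k0 : ∀ x y, ‖u x - u y‖ ≤ N * |x - y| ^ β := fun x y =>
    (t0 x y).trans (by gcongr; linarith)
  have k1 : ∀ x y, ‖deriv u x - deriv u y‖ ≤ N * |x - y| ^ β := fun x y =>
    (t1 x y).trans (by gcongr; linarith)
  -- integrability in the variable h
  have J1 : ∀ x : ℝ, Integrable (fun h : ℝ =>
      (|h| ^ (1 + α))⁻¹ • (u x - u (x - h) - h • deriv u x)) := fun x =>
    (ker_integrable hα hα2 (by fun_prop) (taylor_bound (K := max B1 B2) hu1 hu2
      (fun x => (hB1 x).trans (le_max_left _ _))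
      (fun x => (hB2 x).trans (le_max_right _ _)) x)).1
  have Fc : ∀ x, Continuous (FF φ φ₁ u x) := fun x => by unfold FF; fun_prop
  have J2 := fun x => ker_integrable hα hα2 (Fc x) (FF_bound hφ1 hφ2 M1 M2 hu1 n0 n1 x)
  have hder : ∀ x, deriv (fun z : ℝ => φ z • u z) x = φ x • deriv u x + φ₁ x • u x := fun x =>
    ((hφ1 x).smul (hu1 x)).deriv
  have I1 : ∀ x : ℝ, Integrable
          (fun y : ℝ => (|x - y| ^ (1 + α))⁻¹ • (u x - u y - (x - y) • deriv u x)) := by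
    intro x
    have := (J1 x).comp_sub_left x
    simpa only [sub_sub_cancel] using this
  have G : ∀ x : ℝ, Integrable (fun y : ℝ => (|x - y| ^ (1 + α))⁻¹ • FF φ φ₁ u x (x - y)) :=
    fun x => (J2 x).1.comp_sub_left x
  have key : ∀ x y : ℝ, (|x - y| ^ (1 + α))⁻¹ •
            (φ x • u x - φ y • u y - (x - y) • deriv (fun z : ℝ => φ z • u z) x)
      = (|x - y| ^ (1 + α))⁻¹ • FF φ φ₁ u x (x - y)
        + φ x • ((|x - y| ^ (1 + α))⁻¹ • (u x - u y - (x - y) • deriv u x)) := by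
    intro x y
    rw [hder, FF, sub_sub_cancel]
    module
  have I2 : ∀ x : ℝ, Integrable
          (fun y : ℝ => (|x - y| ^ (1 + α))⁻¹ •
            (φ x • u x - φ y • u y - (x - y) • deriv (fun z : ℝ => φ z • u z) x)) := by
    intro x
    simp only [key]
    exact (G x).add ((I1 x).smul (φ x))
  refine ⟨I1, I2, ?_⟩
  have comm : ∀ x, fracLap α (fun z : ℝ => φ z • u z) x - φ x • fracLap α u x
      = Calpha α • ∫ h : ℝ, (|h| ^ (1 + α))⁻¹ • FF φ φ₁ u x h := by
    intro x
    unfold fracLap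
    simp only [key]
    have I1s : Integrable (fun y : ℝ =>
        φ x • ((|x - y| ^ (1 + α))⁻¹ • (u x - u y - (x - y) • deriv u x))) := (I1 x).smul (φ x)
    rw [integral_add (G x) I1s, integral_smul,
      integral_sub_left_eq_self (fun h : ℝ => (|h| ^ (1 + α))⁻¹ • FF φ φ₁ u x h) volume x]
    module
  simp only [comm]
  have S : supNorm (fun x : ℝ => Calpha α • ∫ h : ℝ, (|h| ^ (1 + α))⁻¹ • FF φ φ₁ u x h)
      ≤ |Calpha α| * (4 * M * N * I) := by
    refine ciSup_le fun x => ?_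
    rw [norm_smul, Real.norm_eq_abs]
    gcongr
    exact (J2 x).2
  have H : holderSemi β (fun x : ℝ => Calpha α • ∫ h : ℝ, (|h| ^ (1 + α))⁻¹ • FF φ φ₁ u x h)
      ≤ |Calpha α| * (12 * M * N * I) := by
    refine Real.iSup_le ?_ (by positivity)
    rintro ⟨⟨x, y⟩, hxy⟩
    have hp : 0 < |x - y| ^ β :=
      Real.rpow_pos_of_pos (abs_pos.2 (sub_ne_zero.2 hxy)) _
    simp only
    rw [div_le_iff₀ hp, ← smul_sub, norm_smul, Real.norm_eq_abs, mul_assoc,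
      ← integral_sub (J2 x).1 (J2 y).1]
    simp only [← smul_sub]
    gcongr
    have := (ker_integrable hα hα2 ((Fc x).sub (Fc y))
      (FF_holder hβ hβ1 hφ1 hφ2 hφ3 M1 M2 M3 hu1 n0 n1 k0 k1 x y)).2
    refine this.trans (le_of_eq ?_)
    ring
  calc _ ≤ |Calpha α| * (4 * M * N * I) + |Calpha α| * (12 * M * N * I) := add_le_add S H
    _ ≤ _ := by linarith
end
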